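/- arXiv:2005.08134 — 7 statements merged into one kernel-verified Lean document; each statement's English description precedes it below -/
import Mathlib

section
/- (Theorem 1.1, ICC curve of the SIR model.) Let N > 0, β > 0, γ > 0, R₀ = β/γ, and 0 < κ < 1. Suppose S, I, R : ℝ → ℝ are differentiable, satisfy S'(t) = -β S(t) I(t)/N, I'(t) = β S(t) I(t)/N - γ I(t), R'(t) = γ I(t), with S(t) + I(t) + R(t) = N for all t, R(0) = 0, S(0) = κN, and S(t) > 0 for all t. Define the cumulative case count C(t) = I(t) + R(t). Then for all t, C'(t) = G_{κ,N}(C(t)), where G_{κ,N}(C) = β · (C + (N/R₀)·ln(1 − C/N) − (N/R₀)·ln κ) · (1 − C/N). -/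
/-- Theorem 1.1, ICC curve of the SIR model: for an SIR outbreak with
total population N, contact rate β, recovery rate γ, R₀ = β/γ, and κ = S(0)/N ∈ (0,1),
the cumulative case count C = I + R satisfies C' = G_{κ,N}(C), where
G_{κ,N}(C) = β(C + (N/R₀)ln(1 − C/N) − (N/R₀)ln κ)(1 − C/N). -/
theorem sir_icc_curve
    (N β γ κ : ℝ) (hN : 0 < N) (hβ : 0 < β) (hγ : 0 < γ) (hκ0 : 0 < κ) (hκ1 : κ < 1)
    (S I R : ℝ → ℝ)
    (hS : Differentiable ℝ S) (hI : Differentiable ℝ I) (hR : Differentiable ℝ R)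
    (hSeq : ∀ t, deriv S t = -β * S t * I t / N)
    (hIeq : ∀ t, deriv I t = β * S t * I t / N - γ * I t)
    (hReq : ∀ t, deriv R t = γ * I t)
    (hsum : ∀ t, S t + I t + R t = N)
    (hR0 : R 0 = 0) (hS0 : S 0 = κ * N) (hSpos : ∀ t, 0 < S t) :
    ∀ t, deriv (fun u => I u + R u) t =
      β * ((I t + R t) + (N / (β / γ)) * Real.log (1 - (I t + R t) / N)
            - (N / (β / γ)) * Real.log κ) * (1 - (I t + R t) / N) := by
  intro t
  have hd : ∀ u, HasDerivAt (fun u => Real.log (S u) + β / (γ * N) * R u) 0 u := by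
    intro u
    have h1 := ((hS u).hasDerivAt.log (hSpos u).ne').add
      ((hR u).hasDerivAt.const_mul (β / (γ * N)))
    have hs := (hSpos u).ne'
    have he : deriv S u / S u + β / (γ * N) * deriv R u = 0 := by
      rw [hSeq, hReq]
      field_simp
      ring
    rw [he] at h1
    exact h1
  have hc := is_const_of_deriv_eq_zero (fun u => (hd u).differentiableAt)
    (fun u => (hd u).deriv) t 0
  simp only [hR0, hS0, mul_zero, add_zero] at hc
  rw [Real.log_mul hκ0.ne' hN.ne'] at hc
  have hfrac : 1 - (I t + R t) / N = S t / N := by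
    field_simp
    linarith [hsum t]
  have hlog : Real.log (S t) = Real.log κ + Real.log N - β / (γ * N) * R t := by linarith
  have hder : deriv (fun u => I u + R u) t = deriv I t + deriv R t :=
    ((hI t).hasDerivAt.add (hR t).hasDerivAt).deriv
  rw [hder, hIeq, hReq, hfrac, Real.log_div (hSpos t).ne' hN.ne', hlog]
  field_simp
  ring
end

section
/- (Converse reconstruction.) Let N > 0, β > 0, γ > 0, R₀ = β/γ, and 0 < κ < 1. Suppose C : ℝ → ℝ is differentiable, satisfies 0 < C(t) < N for all t, and solves the ODE C'(t) = G_{κ,N}(C(t)), where G_{κ,N}(C) = β(C + (N/R₀)ln(1 − C/N) − (N/R₀)ln κ)(1 − C/N). Define S(t) = N − C(t), R(t) = −(N/R₀)·ln((1 − C(t)/N)/κ), and I(t) = C(t) − R(t). Then S + I + R = N identically, and S, I, R satisfy the SIR equations S' = −βSI/N, I' = βSI/N − γI, R' = γI. -/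
/-- Converse reconstruction: if C solves the scalar ODE
C' = G_{κ,N}(C) with 0 < C < N, then S = N − C, R = −(N/R₀)ln((1 − C/N)/κ),
I = C − R satisfy S + I + R = N and the SIR equations. -/
theorem icc_reconstructs_sir
    (N β γ κ : ℝ) (hN : 0 < N) (hβ : 0 < β) (hγ : 0 < γ) (hκ0 : 0 < κ) (hκ1 : κ < 1)
    (C : ℝ → ℝ) (hC : Differentiable ℝ C)
    (hCrange : ∀ t, 0 < C t ∧ C t < N)
    (hode : ∀ t, deriv C t =
      β * (C t + (N / (β / γ)) * Real.log (1 - C t / N)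
            - (N / (β / γ)) * Real.log κ) * (1 - C t / N)) :
    let S : ℝ → ℝ := fun t => N - C t
    let R : ℝ → ℝ := fun t => -(N / (β / γ)) * Real.log ((1 - C t / N) / κ)
    let I : ℝ → ℝ := fun t => C t - R t
    (∀ t, S t + I t + R t = N) ∧
    (∀ t, deriv S t = -β * S t * I t / N) ∧
    (∀ t, deriv I t = β * S t * I t / N - γ * I t) ∧
    (∀ t, deriv R t = γ * I t) := by
  intro S R I
  have hp : ∀ t, 0 < 1 - C t / N := fun t => by
    have := (div_lt_one hN).2 (hCrange t).2
    linarith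
  have hCd : ∀ t, HasDerivAt C (β * I t * (1 - C t / N)) t := fun t => by
    have h := (hC t).hasDerivAt
    rw [hode t] at h
    refine h.congr_deriv ?_
    simp only [I, R]
    rw [Real.log_div (hp t).ne' hκ0.ne']
    ring
  have hRd : ∀ t, HasDerivAt R (γ * I t) t := fun t => by
    have h1 := ((((hCd t).div_const N).const_sub 1).div_const κ).log
      (div_pos (hp t) hκ0).ne'
    have h2 := h1.const_mul (-(N / (β / γ)))
    refine h2.congr_deriv ?_
    have hq := (hp t).ne'
    generalize 1 - C t / N = q at *
    field_simp
  refine ⟨fun t => ?_, fun t => ?_, fun t => ?_, fun t => (hRd t).deriv⟩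
  · simp only [S, I]
    ring
  · rw [((hCd t).const_sub N).deriv]
    simp only [S]
    field_simp
  · have hI : HasDerivAt I (β * I t * (1 - C t / N) - γ * I t) t := (hCd t).sub (hRd t)
    rw [hI.deriv]
    simp only [S]
    field_simp
end

section
/- (Existence and uniqueness of the final size C∞.) Let N > 0, R₀ > 0, and 0 < κ < 1. Then there exists a unique C∞ with 0 < C∞ < N satisfying the transcendental equation C∞ + (N/R₀)·ln(1 − C∞/N) − (N/R₀)·ln κ = 0; equivalently, N = C∞ + κ·N·exp(−R₀·C∞/N). -/
theorem final_size_aux_uniq (N R κ a b : ℝ) (hN : 0 < N) (hκ0 : 0 < κ) (hκ1 : κ < 1)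
    (ha : 0 < a) (hab : a < b)
    (ea : N = a + κ * N * Real.exp (-R * a / N))
    (eb : N = b + κ * N * Real.exp (-R * b / N)) : False := by
  have hb : 0 < b := ha.trans hab
  have ht0 : 0 < a / b := div_pos ha hb
  have ht1 : a / b < 1 := (div_lt_one hb).2 hab
  have h := convexOn_exp.2 (Set.mem_univ 0) (Set.mem_univ (-R * b / N))
    (sub_nonneg.2 ht1.le) ht0.le (by ring)
  simp only [smul_eq_mul, mul_zero, zero_add, Real.exp_zero, mul_one] at h
  have e : a / b * (-R * b / N) = -R * a / N := by field_simp
  rw [e] at h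
  have hA : a = a / b * b := by field_simp
  have hk : 0 < κ * N := mul_pos hκ0 hN
  have h2 := mul_le_mul_of_nonneg_left h hk.le
  generalize a / b = t at *
  generalize Real.exp (-R * a / N) = x at *
  generalize Real.exp (-R * b / N) = y at *
  have h3 : t * (b + κ * N * y) = t * N := by rw [← eb]
  have h4 : 0 < (1 - t) * (N * (1 - κ)) :=
    mul_pos (by linarith) (mul_pos hN (by linarith))
  nlinarith

/-- Existence and uniqueness of the final size C∞: for N > 0, R₀ > 0,
0 < κ < 1, there is a unique C∞ ∈ (0, N) with
C∞ + (N/R₀)·ln(1 − C∞/N) − (N/R₀)·ln κ = 0; moreover, for C ∈ (0, N), this equation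
is equivalent to N = C + κ·N·exp(−R₀·C/N). -/
theorem final_size_exists_unique
    (N R₀ κ : ℝ) (hN : 0 < N) (hR₀ : 0 < R₀) (hκ0 : 0 < κ) (hκ1 : κ < 1) :
    (∃! Cinf : ℝ, (0 < Cinf ∧ Cinf < N) ∧
      Cinf + (N / R₀) * Real.log (1 - Cinf / N) - (N / R₀) * Real.log κ = 0) ∧
    (∀ C : ℝ, 0 < C → C < N →
      (C + (N / R₀) * Real.log (1 - C / N) - (N / R₀) * Real.log κ = 0 ↔
        N = C + κ * N * Real.exp (-R₀ * C / N))) := by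
  have key : ∀ C : ℝ, 0 < C → C < N →
      (C + (N / R₀) * Real.log (1 - C / N) - (N / R₀) * Real.log κ = 0 ↔
        N = C + κ * N * Real.exp (-R₀ * C / N)) := by
    intro C _ hC1
    have hp : 0 < 1 - C / N := sub_pos.2 ((div_lt_one hN).2 hC1)
    have h1 : C + (N / R₀) * Real.log (1 - C / N) - (N / R₀) * Real.log κ
        = (N / R₀) * (Real.log (1 - C / N) - (Real.log κ + -R₀ * C / N)) := by
      field_simp
      ring
    have h2 : N - (C + κ * N * Real.exp (-R₀ * C / N))
        = N * ((1 - C / N) - κ * Real.exp (-R₀ * C / N)) := by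
      field_simp
      ring
    have h3 : Real.log κ + -R₀ * C / N = Real.log (κ * Real.exp (-R₀ * C / N)) := by
      rw [Real.log_mul hκ0.ne' (Real.exp_pos _).ne', Real.log_exp]
    rw [h1, ← sub_eq_zero (a := N), h2, h3, mul_eq_zero, mul_eq_zero,
      or_iff_right (div_pos hN hR₀).ne', or_iff_right hN.ne', sub_eq_zero, sub_eq_zero]
    exact Real.log_injOn_pos.eq_iff hp (mul_pos hκ0 (Real.exp_pos _))
  refine ⟨?_, key⟩
  have hc : ContinuousOn (fun x : ℝ => x + κ * N * Real.exp (-R₀ * x / N)) (Set.Icc 0 N) := by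
    fun_prop
  have hm : N ∈ Set.Ioo ((fun x : ℝ => x + κ * N * Real.exp (-R₀ * x / N)) 0)
      ((fun x : ℝ => x + κ * N * Real.exp (-R₀ * x / N)) N) := by
    constructor
    · simp
      nlinarith
    · have : 0 < κ * N * Real.exp (-R₀ * N / N) := by positivity
      simp only
      linarith
  obtain ⟨c, ⟨hc0, hc1⟩, hce⟩ := intermediate_value_Ioo hN.le hc hm
  have hce' : N = c + κ * N * Real.exp (-R₀ * c / N) := hce.symm
  refine ⟨c, ⟨⟨hc0, hc1⟩, (key c hc0 hc1).2 hce'⟩, ?_⟩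
  rintro d ⟨⟨hd0, hd1⟩, hde⟩
  have hde' := (key d hd0 hd1).1 hde
  rcases lt_trichotomy d c with h | h | h
  · exact (final_size_aux_uniq N R₀ κ d c hN hκ0 hκ1 hd0 h hde' hce').elim
  · exact h
  · exact (final_size_aux_uniq N R₀ κ c d hN hκ0 hκ1 hc0 h hce' hde').elim
end

section
/- (Nonnegativity of the ICC curve on the outbreak interval.) Let N > 0, β > 0, γ > 0, R₀ = β/γ, 0 < κ < 1, and let C∞ ∈ (0, N) be the unique solution of C∞ + (N/R₀)·ln(1 − C∞/N) − (N/R₀)·ln κ = 0. Define G_{κ,N}(C) = β(C + (N/R₀)ln(1 − C/N) − (N/R₀)ln κ)(1 − C/N). Then G_{κ,N}(0) = −N·γ·ln κ > 0, G_{κ,N}(C∞) = 0, and G_{κ,N}(C) > 0 for all C ∈ [0, C∞). -/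
/-- Nonnegativity of the ICC curve on the outbreak interval:
with G_{κ,N}(C) = β(C + (N/R₀)ln(1 − C/N) − (N/R₀)ln κ)(1 − C/N) and C∞ ∈ (0,N) the
solution of the final-size equation, one has G_{κ,N}(0) = −Nγ ln κ > 0,
G_{κ,N}(C∞) = 0, and G_{κ,N}(C) > 0 for C ∈ [0, C∞). -/
theorem icc_nonneg_on_outbreak
    (N β γ κ Cinf : ℝ) (hN : 0 < N) (hβ : 0 < β) (hγ : 0 < γ)
    (hκ0 : 0 < κ) (hκ1 : κ < 1) (hCinf0 : 0 < Cinf) (hCinfN : Cinf < N)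
    (hfinal : Cinf + (N / (β / γ)) * Real.log (1 - Cinf / N)
      - (N / (β / γ)) * Real.log κ = 0) :
    let G : ℝ → ℝ := fun C =>
      β * (C + (N / (β / γ)) * Real.log (1 - C / N)
            - (N / (β / γ)) * Real.log κ) * (1 - C / N)
    G 0 = -(N * γ * Real.log κ) ∧ 0 < G 0 ∧ G Cinf = 0 ∧
      ∀ C : ℝ, 0 ≤ C → C < Cinf → 0 < G C := by
  intro G
  have hlog : Real.log κ < 0 := Real.log_neg hκ0 hκ1
  have h0 : G 0 = -(N * γ * Real.log κ) := by
    simp only [G, zero_div, sub_zero, Real.log_one]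
    field_simp
    ring
  refine ⟨h0, ?_, ?_, ?_⟩
  · rw [h0]
    have := mul_neg_of_pos_of_neg (mul_pos hN hγ) hlog
    linarith
  · simp only [G]
    rw [hfinal]
    ring
  · intro C hC0 hC
    have hk : 0 < N / (β / γ) := by positivity
    simp only [G]
    generalize N / (β / γ) = k at *
    have hy : 0 < 1 - Cinf / N := by
      rw [sub_pos, div_lt_one hN]; exact hCinfN
    have hx : 0 < 1 - C / N := by
      rw [sub_pos, div_lt_one hN]; exact hC.trans hCinfN
    have ht0 : 0 ≤ C / Cinf := by positivity
    have ht1 : C / Cinf < 1 := (div_lt_one hCinf0).2 hC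
    have hCt : C = C / Cinf * Cinf := by field_simp
    generalize C / Cinf = t at *
    have hc := strictConcaveOn_log_Ioi.concaveOn.2 (Set.mem_Ioi.2 one_pos)
      (Set.mem_Ioi.2 hy) (sub_nonneg.2 ht1.le) ht0 (by ring)
    have he : (1 - t) * 1 + t * (1 - Cinf / N) = 1 - C / N := by
      rw [hCt]; ring
    simp only [smul_eq_mul, Real.log_one, he, mul_zero, zero_add] at hc
    have h1 := mul_le_mul_of_nonneg_left hc hk.le
    have h2 : 0 < (1 - t) * (k * -Real.log κ) :=
      mul_pos (by linarith) (mul_pos hk (by linarith))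
    refine mul_pos (mul_pos hβ ?_) hx
    have h3 : t * (Cinf + k * Real.log (1 - Cinf / N) - k * Real.log κ) = 0 := by
      rw [hfinal, mul_zero]
    nlinarith
end

section
/- (Structural identifiability of β, γ, κ for known N.) Let N > 0 and let C* ∈ (0, N). Suppose β⁽¹⁾, β⁽²⁾ > 0, γ⁽¹⁾, γ⁽²⁾ > 0, and κ⁽¹⁾, κ⁽²⁾ ∈ (0, 1) are such that for all C ∈ [0, C*]: β⁽¹⁾·C/N + γ⁽¹⁾·ln(1 − C/N) − γ⁽¹⁾·ln κ⁽¹⁾ = β⁽²⁾·C/N + γ⁽²⁾·ln(1 − C/N) − γ⁽²⁾·ln κ⁽²⁾. Then β⁽¹⁾ = β⁽²⁾, γ⁽¹⁾ = γ⁽²⁾, and κ⁽¹⁾ = κ⁽²⁾. -/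
/-- Structural identifiability of β, γ, κ for known N: if two parameter
sets produce the same affine combination β·C/N + γ·ln(1 − C/N) − γ·ln κ for all
C ∈ [0, C*] with 0 < C* < N, then the parameters coincide. -/
theorem sir_structural_identifiability
    (N Cstar : ℝ) (hN : 0 < N) (hCstar0 : 0 < Cstar) (hCstarN : Cstar < N)
    (β₁ β₂ γ₁ γ₂ κ₁ κ₂ : ℝ)
    (hβ₁ : 0 < β₁) (hβ₂ : 0 < β₂) (hγ₁ : 0 < γ₁) (hγ₂ : 0 < γ₂)
    (hκ₁ : 0 < κ₁ ∧ κ₁ < 1) (hκ₂ : 0 < κ₂ ∧ κ₂ < 1)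
    (heq : ∀ C : ℝ, 0 ≤ C → C ≤ Cstar →
      β₁ * (C / N) + γ₁ * Real.log (1 - C / N) - γ₁ * Real.log κ₁ =
      β₂ * (C / N) + γ₂ * Real.log (1 - C / N) - γ₂ * Real.log κ₂) :
    β₁ = β₂ ∧ γ₁ = γ₂ ∧ κ₁ = κ₂ := by
  have hx0 : 0 < Cstar / N := div_pos hCstar0 hN
  have hx1 : Cstar / N < 1 := (div_lt_one hN).2 hCstarN
  have h0 := heq 0 le_rfl hCstar0.le
  have h1 := heq Cstar hCstar0.le le_rfl
  have h2 := heq (Cstar / 2) (by linarith) (by linarith)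
  have e : Cstar / 2 / N = Cstar / N / 2 := by ring
  rw [e] at h2
  simp only [zero_div, sub_zero, Real.log_one, mul_zero, zero_add, zero_sub] at h0
  generalize Cstar / N = x at *
  have hlog : Real.log (1 - x) < 2 * Real.log (1 - x / 2) := by
    have h : Real.log (1 - x) < Real.log ((1 - x / 2) ^ 2) :=
      Real.log_lt_log (by linarith) (by nlinarith [mul_pos hx0 hx0])
    rw [Real.log_pow] at h
    exact_mod_cast h
  have hg : (γ₁ - γ₂) * (2 * Real.log (1 - x / 2) - Real.log (1 - x)) = 0 := by
    linear_combination 2 * h2 - h1 - h0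
  have hγ : γ₁ = γ₂ := by
    rcases mul_eq_zero.1 hg with h | h <;> linarith
  subst hγ
  have hβ : β₁ = β₂ := by
    have : (β₁ - β₂) * x = 0 := by linear_combination h1 - h0
    rcases mul_eq_zero.1 this with h | h <;> linarith
  have hk : Real.log κ₁ = Real.log κ₂ :=
    mul_left_cancel₀ hγ₁.ne' (by linarith)
  exact ⟨hβ, rfl, Real.log_injOn_pos hκ₁.1 hκ₂.1 hk⟩
end

section
/- (Structural identifiability including the population size N.) Let C* > 0. Suppose β⁽¹⁾, β⁽²⁾ > 0, γ⁽¹⁾, γ⁽²⁾ > 0, κ⁽¹⁾, κ⁽²⁾ ∈ (0, 1), and N⁽¹⁾, N⁽²⁾ > C* are such that for all C ∈ [0, C*]: β⁽¹⁾·C/N⁽¹⁾ + γ⁽¹⁾·ln(1 − C/N⁽¹⁾) − γ⁽¹⁾·ln κ⁽¹⁾ = β⁽²⁾·C/N⁽²⁾ + γ⁽²⁾·ln(1 − C/N⁽²⁾) − γ⁽²⁾·ln κ⁽²⁾. Then N⁽¹⁾ = N⁽²⁾, β⁽¹⁾ = β⁽²⁾, γ⁽¹⁾ = γ⁽²⁾,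 and κ⁽¹⁾ = κ⁽²⁾. -/
theorem sir_aux (β γ k N C : ℝ) (hN : 0 < N) (hC : C < N) :
    HasDerivAt (fun C : ℝ => β * (C / N) + γ * Real.log (1 - C / N) - k)
      (β / N - γ / (N - C)) C := by
  have e : N - C ≠ 0 := by linarith
  have h1 : 1 - C / N ≠ 0 := by
    have : C / N < 1 := (div_lt_one hN).2 hC
    linarith
  have hd : HasDerivAt (fun C : ℝ => C / N) (1 / N) C := (hasDerivAt_id C).div_const N
  have := ((hd.const_mul β).add (((hd.const_sub 1).log h1).const_mul γ)).sub_const k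
  have h2 : 1 - C / N = (N - C) / N := by field_simp
  have h3 : β / N - γ / (N - C) = β * (1 / N) + γ * (-(1 / N) / (1 - C / N)) := by
    rw [h2]
    field_simp
    ring
  rw [h3]
  exact this

/-- Structural identifiability including the population size N: if two
parameter sets, each with its own population size N⁽ⁱ⁾ > C*, produce the same function
C ↦ β·C/N + γ·ln(1 − C/N) − γ·ln κ on [0, C*], then all four parameters coincide. -/
theorem sir_structural_identifiability_with_N
    (Cstar : ℝ) (hCstar : 0 < Cstar)
    (β₁ β₂ γ₁ γ₂ κ₁ κ₂ N₁ N₂ : ℝ)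
    (hβ₁ : 0 < β₁) (hβ₂ : 0 < β₂) (hγ₁ : 0 < γ₁) (hγ₂ : 0 < γ₂)
    (hκ₁ : 0 < κ₁ ∧ κ₁ < 1) (hκ₂ : 0 < κ₂ ∧ κ₂ < 1)
    (hN₁ : Cstar < N₁) (hN₂ : Cstar < N₂)
    (heq : ∀ C : ℝ, 0 ≤ C → C ≤ Cstar →
      β₁ * (C / N₁) + γ₁ * Real.log (1 - C / N₁) - γ₁ * Real.log κ₁ =
      β₂ * (C / N₂) + γ₂ * Real.log (1 - C / N₂) - γ₂ * Real.log κ₂) :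
    N₁ = N₂ ∧ β₁ = β₂ ∧ γ₁ = γ₂ ∧ κ₁ = κ₂ := by
  have hN₁0 : 0 < N₁ := hCstar.trans hN₁
  have hN₂0 : 0 < N₂ := hCstar.trans hN₂
  have key : ∀ C : ℝ, 0 < C → C < Cstar →
      (β₁ / N₁ - β₂ / N₂) * ((N₁ - C) * (N₂ - C)) = γ₁ * (N₂ - C) - γ₂ * (N₁ - C) := by
    intro C h0 h1
    have hd := sir_aux β₁ γ₁ (γ₁ * Real.log κ₁) N₁ C hN₁0 (h1.trans hN₁)
    have hd2 := sir_aux β₂ γ₂ (γ₂ * Real.log κ₂) N₂ C hN₂0 (h1.trans hN₂)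
    have he : (fun C : ℝ => β₁ * (C / N₁) + γ₁ * Real.log (1 - C / N₁) - γ₁ * Real.log κ₁)
        =ᶠ[nhds C]
        (fun C : ℝ => β₂ * (C / N₂) + γ₂ * Real.log (1 - C / N₂) - γ₂ * Real.log κ₂) := by
      filter_upwards [Ioo_mem_nhds h0 h1] with x hx
      exact heq x hx.1.le hx.2.le
    have hu := hd.unique (hd2.congr_of_eventuallyEq he)
    have e1 : N₁ - C ≠ 0 := by linarith
    have e2 : N₂ - C ≠ 0 := by linarith
    have hu' : β₁ / N₁ - β₂ / N₂ = γ₁ / (N₁ - C) - γ₂ / (N₂ - C) := by linarith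
    rw [hu']
    field_simp
  have k1 := key (Cstar / 4) (by linarith) (by linarith)
  have k2 := key (Cstar / 2) (by linarith) (by linarith)
  have k3 := key (3 * Cstar / 4) (by linarith) (by linarith)
  generalize ha : β₁ / N₁ - β₂ / N₂ = a at k1 k2 k3
  have ha0 : a = 0 := by
    have : a * Cstar ^ 2 = 0 := by linear_combination 8 * (k1 - 2 * k2 + k3)
    simpa [hCstar.ne'] using this
  subst ha0
  have hγ : γ₁ = γ₂ := by
    have : (γ₁ - γ₂) * Cstar = 0 := by linear_combination 4 * (k2 - k1)
    rcases mul_eq_zero.1 this with h | h <;> linarith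
  subst hγ
  have hN : N₁ = N₂ := by
    have : γ₁ * (N₂ - N₁) = 0 := by linear_combination -k1
    rcases mul_eq_zero.1 this with h | h <;> linarith
  subst hN
  have hβ : β₁ = β₂ := by
    have h := sub_eq_zero.1 ha
    field_simp at h
    exact h
  have hk := heq 0 le_rfl hCstar.le
  refine ⟨rfl, hβ, rfl, ?_⟩
  have hl : γ₁ * Real.log κ₁ = γ₁ * Real.log κ₂ := by simpa using hk
  exact Real.log_injOn_pos hκ₁.1 hκ₂.1 (mul_left_cancel₀ hγ₁.ne' hl)
end

section
/- (Exact mean relative deviation of a Poisson variable.) Let n be a positive integer and let X be a Poisson random variable with mean n. Then the expected relative deviation satisfies E[|X − n|] / n = 2·nⁿ·e^{−n} / n!. -/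
open MeasureTheory

lemma aux_hasSum (n : ℕ) (p : ℕ → ℝ) (hp0 : ∀ k, 0 ≤ p k) (hs : Summable p)
    (hrec : ∀ k : ℕ, ((k : ℝ) + 1) * p (k + 1) = n * p k) :
    HasSum (fun k : ℕ => p k * |(k : ℝ) - n|) (2 * n * p n) := by
  rw [hasSum_iff_tendsto_nat_of_nonneg (fun k => mul_nonneg (hp0 k) (abs_nonneg _))]
  have h1 : ∀ N ≤ n, ∑ k ∈ Finset.range N, p k * |(k : ℝ) - n| = N * p N := by
    intro N
    induction N with
    | zero => intro _; simp
    | succ N ih =>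
      intro h
      have hN : (N : ℝ) ≤ n := by exact_mod_cast (by omega : N ≤ n)
      rw [Finset.sum_range_succ, ih (by omega), abs_of_nonpos (by linarith)]
      push_cast
      rw [hrec]; ring
  have h2 : ∀ M, ∑ k ∈ Finset.range (M + n), p k * |(k : ℝ) - n|
      = 2 * n * p n - ((M + n : ℕ) : ℝ) * p (M + n) := by
    intro M
    induction M with
    | zero => rw [Nat.zero_add, h1 n le_rfl]; ring
    | succ M ih =>
      have hr := hrec (M + n)
      rw [show M + 1 + n = (M + n) + 1 by ring, Finset.sum_range_succ, ih,
        abs_of_nonneg (by push_cast; linarith [(Nat.cast_nonneg M : (0 : ℝ) ≤ M)])]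
      push_cast at hr ⊢
      rw [hr]; ring
  have h3 : Filter.Tendsto (fun N : ℕ => (N : ℝ) * p N) Filter.atTop (nhds 0) := by
    rw [← Filter.tendsto_add_atTop_iff_nat 1]
    have := hs.tendsto_atTop_zero.const_mul (n : ℝ)
    rw [mul_zero] at this
    refine this.congr fun k => ?_
    push_cast
    exact (hrec k).symm
  rw [← Filter.tendsto_add_atTop_iff_nat n]
  have h4 := ((Filter.tendsto_add_atTop_iff_nat n).2 h3).const_sub (2 * n * p n)
  rw [sub_zero] at h4
  exact h4.congr fun M => (h2 M).symm

/-- Exact mean relative deviation of a Poisson variable: if X is a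
Poisson random variable with mean n (a positive integer), then
E[|X − n|] / n = 2·nⁿ·e^{−n} / n!. -/
theorem poisson_mean_relative_deviation
    (n : ℕ) (hn : 0 < n)
    {Ω : Type*} [MeasurableSpace Ω] (μ : Measure Ω) [IsProbabilityMeasure μ]
    (X : Ω → ℕ) (hX : Measurable X)
    (hpois : ∀ k : ℕ, μ {ω | X ω = k} =
      ENNReal.ofReal ((n : ℝ) ^ k * Real.exp (-(n : ℝ)) / (Nat.factorial k))) :
    (∫ ω, |((X ω : ℝ)) - (n : ℝ)| ∂μ) / (n : ℝ) =
      2 * (n : ℝ) ^ n * Real.exp (-(n : ℝ)) / (Nat.factorial n) := by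
  have hmap : μ.map X = ProbabilityTheory.poissonMeasure (n : NNReal) := by
    refine Measure.ext_of_singleton fun k => ?_
    rw [Measure.map_apply hX (measurableSet_singleton k),
      ProbabilityTheory.poissonMeasure_singleton]
    refine (hpois k).trans ?_
    simp [mul_comm]
  have hint : ∫ ω, |((X ω : ℝ)) - (n : ℝ)| ∂μ = ∫ k, |(k : ℝ) - (n : ℝ)| ∂(μ.map X) :=
    (integral_map (f := fun k : ℕ => |(k : ℝ) - (n : ℝ)|) hX.aemeasurable
      Measurable.of_discrete.aestronglyMeasurable).symm
  have hn' : (n : ℝ) ≠ 0 := by exact_mod_cast hn.ne'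
  have hs := aux_hasSum n
    (fun k => Real.exp (-((n : NNReal) : ℝ)) * ((n : NNReal) : ℝ) ^ k / (Nat.factorial k))
    (fun k => by positivity) (ProbabilityTheory.hasSum_one_poissonMeasure (n : NNReal)).summable
    (fun k => by
      have : (Nat.factorial k : ℝ) ≠ 0 := by positivity
      have : (k : ℝ) + 1 ≠ 0 := by positivity
      simp only [Nat.factorial_succ, NNReal.coe_natCast]
      push_cast
      field_simp
      ring)
  rw [hint, hmap, ProbabilityTheory.integral_poissonMeasure]
  simp only [smul_eq_mul]
  rw [hs.tsum_eq]
  simp only [NNReal.coe_natCast]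
  field_simp
end
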